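/- Let E ⊆ ℂ be a compact, totally disconnected set of positive two-dimensional Lebesgue measure. Then there exists a homeomorphism f : ℂ → ℂ which is complex-differentiable at every point of ℂ ∖ E but is not the restriction of a Möbius transformation. (In particular, totally disconnected compact sets of positive area are not conformally removable, and circle domains whose boundary is such a set are not conformally rigid.) -/

import Mathlib

open Set Metric Complex Filter MeasureTheory Topology ENNReal NNReal

noncomputable section

/-- `f` agrees on `U` with a Möbius transformation. -/
def IsMobiusOn (f : ℂ → ℂ) (U : Set ℂ) : Prop :=
  ∃ a b c d : ℂ, a * d - b * c ≠ 0 ∧ ∀ z ∈ U, c * z + d ≠ 0 ∧ f z = (a * z + b) / (c * z + d)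

/-- The kernel `1 / z`, truncated to the linear function `conj z / δ ^ 2` on the disc of
radius `δ`. -/
def truncKernel (δ : ℝ) (z : ℂ) : ℂ := starRingEnd ℂ z / ((max ‖z‖ δ : ℝ) : ℂ) ^ 2

lemma norm_truncKernel_le {δ : ℝ} (hδ : 0 < δ) (z : ℂ) : ‖truncKernel δ z‖ ≤ (max ‖z‖ δ)⁻¹ := by
  have hm : 0 < max ‖z‖ δ := lt_max_of_lt_right hδ
  rw [truncKernel, norm_div, norm_pow, Complex.norm_real, Real.norm_of_nonneg hm.le,
    RCLike.norm_conj, div_le_iff₀ (by positivity)]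
  calc ‖z‖ ≤ max ‖z‖ δ := le_max_left _ _
    _ = _ := by field_simp

lemma truncKernel_eq_inv {δ : ℝ} {z : ℂ} (hδ : 0 < δ) (hz : δ ≤ ‖z‖) : truncKernel δ z = z⁻¹ := by
  have : z ≠ 0 := by rintro rfl; simp at hz; linarith
  rw [truncKernel, max_eq_left hz, Complex.inv_def, Complex.normSq_eq_norm_sq]
  push_cast
  rfl

lemma norm_sub_sq_eq (a b : ℂ) :
    ‖a - b‖ ^ 2 = ‖a‖ ^ 2 + ‖b‖ ^ 2 - 2 * (a.re * b.re + a.im * b.im) := by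
  rw [← Complex.normSq_eq_norm_sq, ← Complex.normSq_eq_norm_sq, ← Complex.normSq_eq_norm_sq]
  simp only [Complex.normSq_apply, Complex.sub_re, Complex.sub_im]
  ring

lemma norm_truncKernel_sub_le {δ : ℝ} (hδ : 0 < δ) (a b : ℂ) :
    ‖truncKernel δ a - truncKernel δ b‖ ≤ ‖a - b‖ * ((max ‖a‖ δ)⁻¹ * (max ‖b‖ δ)⁻¹) := by
  have hm : 0 < max ‖a‖ δ := lt_max_of_lt_right hδ
  have hn : 0 < max ‖b‖ δ := lt_max_of_lt_right hδ
  have e1 : truncKernel δ a = starRingEnd ℂ (((((max ‖a‖ δ) ^ 2)⁻¹ : ℝ) : ℂ) * a) := by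
    rw [truncKernel, map_mul, Complex.conj_ofReal]; push_cast; ring
  have e2 : truncKernel δ b = starRingEnd ℂ (((((max ‖b‖ δ) ^ 2)⁻¹ : ℝ) : ℂ) * b) := by
    rw [truncKernel, map_mul, Complex.conj_ofReal]; push_cast; ring
  rw [e1, e2, ← map_sub, RCLike.norm_conj]
  refine le_of_sq_le_sq ?_ (by positivity)
  rw [norm_sub_sq_eq, mul_pow, norm_sub_sq_eq, norm_mul, norm_mul, Complex.norm_real,
    Complex.norm_real, Real.norm_of_nonneg (by positivity), Real.norm_of_nonneg (by positivity)]
  simp only [Complex.re_ofReal_mul, Complex.im_ofReal_mul]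
  have key : ((max ‖b‖ δ) ^ 2 - (max ‖a‖ δ) ^ 2) *
      (‖a‖ ^ 2 * (max ‖b‖ δ) ^ 2 - ‖b‖ ^ 2 * (max ‖a‖ δ) ^ 2) ≤ 0 := by
    rcases le_total ‖a‖ δ with ha | ha <;> rcases le_total ‖b‖ δ with hb | hb
    · simp [max_eq_right ha, max_eq_right hb]
    · rw [max_eq_right ha, max_eq_left hb]
      have h1 : δ ^ 2 ≤ ‖b‖ ^ 2 := by gcongr
      have h2 : ‖a‖ ^ 2 ≤ δ ^ 2 := by gcongr
      nlinarith [mul_nonneg (sub_nonneg.2 h1) (mul_nonneg (sq_nonneg ‖b‖) (sub_nonneg.2 h2))]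
    · rw [max_eq_left ha, max_eq_right hb]
      have h1 : δ ^ 2 ≤ ‖a‖ ^ 2 := by gcongr
      have h2 : ‖b‖ ^ 2 ≤ δ ^ 2 := by gcongr
      nlinarith [mul_nonneg (sub_nonneg.2 h1) (mul_nonneg (sq_nonneg ‖a‖) (sub_nonneg.2 h2))]
    · rw [max_eq_left ha, max_eq_left hb]
      nlinarith
  generalize max ‖a‖ δ = m at *
  generalize max ‖b‖ δ = n at *
  rw [← sub_nonneg]
  have : (‖a‖ ^ 2 + ‖b‖ ^ 2 - 2 * (a.re * b.re + a.im * b.im)) * (m⁻¹ * n⁻¹) ^ 2 -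
      (((m ^ 2)⁻¹ * ‖a‖) ^ 2 + ((n ^ 2)⁻¹ * ‖b‖) ^ 2 -
        2 * ((m ^ 2)⁻¹ * a.re * ((n ^ 2)⁻¹ * b.re) + (m ^ 2)⁻¹ * a.im * ((n ^ 2)⁻¹ * b.im))) =
      -((n ^ 2 - m ^ 2) * (‖a‖ ^ 2 * n ^ 2 - ‖b‖ ^ 2 * m ^ 2)) / (m ^ 4 * n ^ 4) := by
    field_simp
    ring
  rw [this]
  exact div_nonneg (by linarith) (by positivity)

lemma continuous_truncKernel {δ : ℝ} (hδ : 0 < δ) : Continuous (truncKernel δ) := by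
  unfold truncKernel
  refine Continuous.div (by fun_prop) (by fun_prop) fun z => ?_
  have : 0 < max ‖z‖ δ := lt_max_of_lt_right hδ
  exact pow_ne_zero 2 (by exact_mod_cast ne_of_gt this)

/-- The real-linear map `h ↦ p * h + q * conj h`. -/
def wirtinger (p q : ℂ) : ℂ →L[ℝ] ℂ :=
  p • (1 : ℂ →L[ℝ] ℂ) + q • (Complex.conjCLE : ℂ →L[ℝ] ℂ)

lemma wirtinger_apply (p q h : ℂ) : wirtinger p q h = p * h + q * starRingEnd ℂ h := rfl

/-- The holomorphic part of the derivative of `truncKernel δ`. -/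
def truncKernelDz (δ : ℝ) (z : ℂ) : ℂ := if δ < ‖z‖ then -(z ^ 2)⁻¹ else 0

/-- The antiholomorphic part of the derivative of `truncKernel δ`. -/
def truncKernelDzbar (δ : ℝ) (z : ℂ) : ℂ := if ‖z‖ < δ then ((δ : ℂ) ^ 2)⁻¹ else 0

lemma hasFDerivAt_truncKernel {δ : ℝ} (hδ : 0 < δ) {z : ℂ} (hz : ‖z‖ ≠ δ) :
    HasFDerivAt (truncKernel δ) (wirtinger (truncKernelDz δ z) (truncKernelDzbar δ z)) z := by
  rcases lt_or_gt_of_ne hz with h | h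
  · have e : truncKernel δ =ᶠ[𝓝 z] fun y => ((δ : ℂ) ^ 2)⁻¹ * (Complex.conjCLE : ℂ →L[ℝ] ℂ) y := by
      filter_upwards [(isOpen_lt continuous_norm continuous_const).mem_nhds h] with y hy
      have hy' : ‖y‖ < δ := hy
      simp only [truncKernel, max_eq_right hy'.le]
      rw [div_eq_inv_mul]; rfl
    refine HasFDerivAt.congr_of_eventuallyEq ?_ e
    have e2 : wirtinger (truncKernelDz δ z) (truncKernelDzbar δ z) =
        ((δ : ℂ) ^ 2)⁻¹ • (Complex.conjCLE : ℂ →L[ℝ] ℂ) := by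
      ext1 h'
      simp [wirtinger_apply, truncKernelDz, truncKernelDzbar, h, h.le]
    rw [e2]
    exact ((Complex.conjCLE : ℂ →L[ℝ] ℂ).hasFDerivAt (x := z)).const_smul (((δ : ℂ) ^ 2)⁻¹)
  · have h0 : z ≠ 0 := by rintro rfl; simp at h; linarith
    have e : truncKernel δ =ᶠ[𝓝 z] fun y => y⁻¹ := by
      filter_upwards [(isOpen_lt continuous_const continuous_norm).mem_nhds h] with y hy
      exact truncKernel_eq_inv hδ (le_of_lt hy)
    refine HasFDerivAt.congr_of_eventuallyEq ?_ e
    convert (hasDerivAt_inv h0).complexToReal_fderiv using 1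
    ext1 h'
    simp [wirtinger_apply, truncKernelDz, truncKernelDzbar, h, h.le]

lemma norm_truncKernelDz_le {δ : ℝ} (hδ : 0 < δ) (z : ℂ) :
    ‖truncKernelDz δ z‖ ≤ ((max ‖z‖ δ) ^ 2)⁻¹ := by
  rw [truncKernelDz]
  split_ifs with h
  · rw [max_eq_left h.le]; simp
  · simp only [norm_zero]; positivity

lemma norm_truncKernelDz_le' {δ : ℝ} (hδ : 0 < δ) (z : ℂ) :
    ‖truncKernelDz δ z‖ ≤ (δ ^ 2)⁻¹ :=
  (norm_truncKernelDz_le hδ z).trans (by gcongr; exact le_max_right _ _)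

lemma norm_truncKernelDzbar_le {δ : ℝ} (hδ : 0 < δ) (z : ℂ) :
    ‖truncKernelDzbar δ z‖ ≤ (δ ^ 2)⁻¹ := by
  rw [truncKernelDzbar]
  split_ifs with h
  · simp
  · simp only [norm_zero]; positivity

lemma measurable_truncKernelDz (δ : ℝ) : Measurable (truncKernelDz δ) :=
  Measurable.ite (measurableSet_lt measurable_const measurable_norm)
    (by fun_prop) measurable_const

lemma measurable_truncKernelDzbar (δ : ℝ) : Measurable (truncKernelDzbar δ) :=
  Measurable.ite (measurableSet_lt measurable_norm measurable_const)
    measurable_const measurable_const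

/-- A truncation of the radial profile `1 / r ^ 2`. -/
def radialProfile (s r : ℝ) : ℝ := (r * max r s)⁻¹

lemma radialProfile_nonneg {s r : ℝ} (hr : 0 ≤ r) : 0 ≤ radialProfile s r :=
  inv_nonneg.2 (mul_nonneg hr (hr.trans (le_max_left _ _)))

lemma measurable_radialProfile (s : ℝ) : Measurable (radialProfile s) := by
  unfold radialProfile; fun_prop

lemma mul_indicator_radialProfile {s y : ℝ} (hy : 0 < y) :
    y * (Iio 1).indicator (radialProfile s) y = (Iio 1).indicator (fun y => (max y s)⁻¹) y := by
  by_cases h : y < 1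
  · rw [indicator_of_mem (show y ∈ Iio 1 from h), indicator_of_mem (show y ∈ Iio 1 from h),
      radialProfile, mul_inv, mul_inv_cancel_left₀ hy.ne']
  · rw [indicator_of_notMem (show y ∉ Iio 1 from h), indicator_of_notMem (show y ∉ Iio 1 from h),
      mul_zero]

lemma integral_inv_max {s : ℝ} (hs : 0 < s) (hs1 : s ≤ 1) :
    ∫ y in Ioi (0 : ℝ), (Iio 1).indicator (fun y => (max y s)⁻¹) y = 1 + Real.log s⁻¹ := by
  have hc : Continuous fun y : ℝ => (max y s)⁻¹ :=
    Continuous.inv₀ (by fun_prop) fun y => (lt_max_of_lt_right hs).ne'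
  rw [setIntegral_indicator measurableSet_Iio, Ioi_inter_Iio, ← integral_Ioc_eq_integral_Ioo,
    ← intervalIntegral.integral_of_le zero_le_one,
    ← intervalIntegral.integral_add_adjacent_intervals (hc.intervalIntegrable 0 s)
      (hc.intervalIntegrable s 1)]
  have h1 : ∫ y in (0 : ℝ)..s, (max y s)⁻¹ = ∫ y in (0 : ℝ)..s, s⁻¹ := by
    refine intervalIntegral.integral_congr fun y hy => ?_
    rw [uIcc_of_le hs.le] at hy
    simp only [max_eq_right hy.2]
  have h2 : ∫ y in s..1, (max y s)⁻¹ = ∫ y in s..1, y⁻¹ := by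
    refine intervalIntegral.integral_congr fun y hy => ?_
    rw [uIcc_of_le hs1] at hy
    simp only [max_eq_left hy.1]
  rw [h1, h2, integral_inv_of_pos hs one_pos]
  simp [hs.ne']

lemma integrableOn_inv_max {s : ℝ} (hs : 0 < s) :
    IntegrableOn ((Iio 1).indicator fun y => (max y s)⁻¹) (Ioi (0 : ℝ)) := by
  have hc : Continuous fun y : ℝ => (max y s)⁻¹ :=
    Continuous.inv₀ (by fun_prop) fun y => (lt_max_of_lt_right hs).ne'
  rw [IntegrableOn, integrable_indicator_iff measurableSet_Iio, IntegrableOn,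
    Measure.restrict_restrict measurableSet_Iio, Iio_inter_Ioi]
  exact (hc.integrableOn_Icc (a := 0) (b := 1)).mono_set Ioo_subset_Icc_self

lemma integrable_radial {s : ℝ} (hs : 0 < s) :
    Integrable fun z : ℂ => (Iio 1).indicator (radialProfile s) ‖z‖ := by
  rw [integrable_fun_norm_addHaar (volume : Measure ℂ)]
  refine (integrableOn_inv_max hs).congr_fun (fun y hy => ?_) measurableSet_Ioi
  rw [← mul_indicator_radialProfile hy]
  simp

lemma integral_radial {s : ℝ} (hs : 0 < s) (hs1 : s ≤ 1) :
    ∫ z : ℂ, (Iio 1).indicator (radialProfile s) ‖z‖ = 2 * Real.pi * (1 + Real.log s⁻¹) := by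
  rw [integral_fun_norm_addHaar (volume : Measure ℂ), ← integral_inv_max hs hs1]
  have : ∫ y in Ioi (0 : ℝ), y ^ (Module.finrank ℝ ℂ - 1) • (Iio 1).indicator (radialProfile s) y =
      ∫ y in Ioi (0 : ℝ), (Iio 1).indicator (fun y => (max y s)⁻¹) y := by
    refine setIntegral_congr_fun measurableSet_Ioi fun y hy => ?_
    rw [← mul_indicator_radialProfile hy]
    simp
  rw [this]
  simp [Measure.real, Complex.volume_ball, mul_assoc]

lemma radialProfile_le (s r : ℝ) :
    radialProfile s r ≤ (Iio 1).indicator (radialProfile s) r + 1 := by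
  by_cases h : r < 1
  · rw [indicator_of_mem (show r ∈ Iio 1 from h)]; linarith
  · rw [indicator_of_notMem (show r ∉ Iio 1 from h), zero_add, radialProfile]
    push Not at h
    exact inv_le_one_of_one_le₀ (one_le_mul_of_one_le_of_one_le h (h.trans (le_max_left _ _)))

section radialBounds

variable {A : Set ℂ}

lemma integrableOn_radialProfile {s : ℝ} (hs : 0 < s) (hAfin : volume A ≠ ⊤) (z : ℂ) :
    IntegrableOn (fun w => radialProfile s ‖z - w‖) A := by
  have h1 : IntegrableOn (fun w => (Iio 1).indicator (radialProfile s) ‖z - w‖ + 1) A :=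
    (((integrable_radial hs).comp_sub_left z).integrableOn).add
      (integrableOn_const hAfin)
  refine h1.mono' ?_ (Eventually.of_forall fun w => ?_)
  · exact ((measurable_radialProfile s).comp (by fun_prop)).aestronglyMeasurable
  · rw [Real.norm_of_nonneg (radialProfile_nonneg (norm_nonneg _))]
    exact radialProfile_le _ _

lemma integral_radialProfile_le {s : ℝ} (hs : 0 < s) (hs1 : s ≤ 1) (hAfin : volume A ≠ ⊤) (z : ℂ) :
    ∫ w in A, radialProfile s ‖z - w‖ ≤
      2 * Real.pi * (1 + Real.log s⁻¹) + volume.real A := by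
  have h0 := (integrable_radial hs).comp_sub_left z
  calc ∫ w in A, radialProfile s ‖z - w‖
      ≤ ∫ w in A, ((Iio 1).indicator (radialProfile s) ‖z - w‖ + 1) :=
        integral_mono (integrableOn_radialProfile hs hAfin z)
          (h0.integrableOn.add (integrableOn_const hAfin))
          fun w => radialProfile_le _ _
    _ = (∫ w in A, (Iio 1).indicator (radialProfile s) ‖z - w‖) + volume.real A := by
        rw [integral_add h0.integrableOn (integrableOn_const hAfin)]; simp
    _ ≤ (∫ w, (Iio 1).indicator (radialProfile s) ‖z - w‖) + volume.real A := by
        refine add_le_add_left (setIntegral_le_integral h0 (Eventually.of_forall fun w => ?_)) _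
        exact indicator_apply_nonneg fun _ => radialProfile_nonneg (norm_nonneg _)
    _ = _ := by
        rw [integral_sub_left_eq_self (fun w : ℂ => (Iio 1).indicator (radialProfile s) ‖w‖)
          volume z, integral_radial hs hs1]

end radialBounds

/-- The Cauchy transform of the indicator function of `A`, with truncated kernel. -/
def truncField (δ : ℝ) (A : Set ℂ) (z : ℂ) : ℂ := ∫ w in A, truncKernel δ (z - w)

/-- `1 + log⁺ (1 / d)`. -/
def logScale (d : ℝ) : ℝ := 1 + max 0 (-Real.log d)

lemma one_le_logScale (d : ℝ) : 1 ≤ logScale d := by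
  have := le_max_left 0 (-Real.log d)
  rw [logScale]; linarith

section truncFieldBounds

variable {A : Set ℂ} {δ : ℝ}

lemma integrableOn_truncKernel (hδ : 0 < δ) (hA : volume A ≠ ⊤) (z : ℂ) :
    IntegrableOn (fun w => truncKernel δ (z - w)) A := by
  refine (integrableOn_const hA (C := δ⁻¹)).mono'
    ((continuous_truncKernel hδ).comp (by fun_prop)).aestronglyMeasurable
    (Eventually.of_forall fun w => (norm_truncKernel_le hδ _).trans ?_)
  gcongr
  exact le_max_right _ _

lemma norm_truncKernel_le_radialProfile (hδ : 0 < δ) (z : ℂ) :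
    ‖truncKernel δ z‖ ≤ radialProfile 1 ‖z‖ + 1 := by
  rcases eq_or_ne z 0 with rfl | hz
  · simp [truncKernel, radialProfile]
  have h0 : 0 < ‖z‖ := norm_pos_iff.2 hz
  refine (norm_truncKernel_le hδ z).trans ((inv_anti₀ h0 (le_max_left _ _)).trans ?_)
  rw [radialProfile]
  rcases le_total ‖z‖ 1 with h | h
  · rw [max_eq_right h, mul_one]; linarith
  · have h1 : ‖z‖⁻¹ ≤ 1 := inv_le_one_of_one_le₀ h
    have : 0 ≤ (‖z‖ * max ‖z‖ 1)⁻¹ := by positivity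
    linarith

lemma norm_truncField_le (hδ : 0 < δ) (hA : volume A ≠ ⊤) (z : ℂ) :
    ‖truncField δ A z‖ ≤ 2 * Real.pi + 2 * volume.real A := by
  have h1 := (integrableOn_radialProfile (A := A) one_pos hA z).add
    (integrableOn_const hA (C := (1 : ℝ)))
  calc ‖truncField δ A z‖ ≤ ∫ w in A, (radialProfile 1 ‖z - w‖ + 1) :=
        norm_integral_le_of_norm_le h1
          (Eventually.of_forall fun w => norm_truncKernel_le_radialProfile hδ _)
    _ = (∫ w in A, radialProfile 1 ‖z - w‖) + volume.real A := by
        rw [integral_add (integrableOn_radialProfile one_pos hA z) (integrableOn_const hA)]; simp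
    _ ≤ _ := by
        have := integral_radialProfile_le (A := A) one_pos le_rfl hA z
        simp at this
        linarith

lemma inv_mul_inv_le_radialProfile {s a b : ℝ} (ha : 0 < a) (hb : 0 < b)
    (hab : 2 * s ≤ a + b) :
    (max a δ)⁻¹ * (max b δ)⁻¹ ≤ radialProfile s a + radialProfile s b := by
  have h1 : (max a δ)⁻¹ * (max b δ)⁻¹ ≤ (a * b)⁻¹ := by
    rw [mul_inv]
    exact mul_le_mul (inv_anti₀ ha (le_max_left _ _)) (inv_anti₀ hb (le_max_left _ _))
      (inv_nonneg.2 (hb.le.trans (le_max_left _ _))) (inv_nonneg.2 ha.le)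
  refine h1.trans ?_
  have pa := radialProfile_nonneg (s := s) ha.le
  have pb := radialProfile_nonneg (s := s) hb.le
  have m1 : 0 < max a s := lt_max_of_lt_left ha
  have m2 : 0 < max b s := lt_max_of_lt_left hb
  rcases le_total a b with h | h
  · have : (a * b)⁻¹ ≤ radialProfile s a := by
      refine inv_anti₀ (by positivity) ?_
      gcongr
      exact max_le h (by linarith)
    linarith
  · have : (a * b)⁻¹ ≤ radialProfile s b := by
      rw [mul_comm]
      refine inv_anti₀ (by positivity) ?_
      gcongr
      exact max_le h (by linarith)
    linarith

lemma truncField_sub (hδ : 0 < δ) (hA : volume A ≠ ⊤) (z z' : ℂ) :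
    truncField δ A z - truncField δ A z' =
      ∫ w in A, (truncKernel δ (z - w) - truncKernel δ (z' - w)) :=
  (integral_sub (integrableOn_truncKernel hδ hA z) (integrableOn_truncKernel hδ hA z')).symm

lemma norm_truncKernel_sub_le_mul (hδ : 0 < δ) (a b : ℂ) :
    ‖truncKernel δ a - truncKernel δ b‖ ≤ (δ ^ 2)⁻¹ * ‖a - b‖ := by
  refine (norm_truncKernel_sub_le hδ a b).trans ?_
  rw [mul_comm, sq, mul_inv]
  gcongr <;> exact le_max_right _ _

lemma norm_truncField_sub_le (hδ : 0 < δ) (hA : volume A ≠ ⊤) (z z' : ℂ) :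
    ‖truncField δ A z - truncField δ A z'‖ ≤ (δ ^ 2)⁻¹ * volume.real A * ‖z - z'‖ := by
  rw [truncField_sub hδ hA]
  refine (norm_setIntegral_le_of_norm_le_const hA.lt_top
    (C := (δ ^ 2)⁻¹ * ‖z - z'‖) fun w _ => ?_).trans (le_of_eq (by ring))
  refine (norm_truncKernel_sub_le_mul hδ _ _).trans_eq ?_
  rw [sub_sub_sub_cancel_right]

lemma norm_truncField_sub_le_log (hδ : 0 < δ) (hA : volume A ≠ ⊤) {z z' : ℂ} (hz : z ≠ z') :
    ‖truncField δ A z - truncField δ A z'‖ ≤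
      (8 * Real.pi + 2 * volume.real A) * logScale ‖z - z'‖ * ‖z - z'‖ := by
  set d := ‖z - z'‖ with hd
  have hd0 : 0 < d := norm_pos_iff.2 (sub_ne_zero.2 hz)
  set s := min (d / 2) 1 with hs
  have hs0 : 0 < s := lt_min (by linarith) one_pos
  have hs1 : s ≤ 1 := min_le_right _ _
  have i1 := integrableOn_radialProfile hs0 hA z
  have i2 := integrableOn_radialProfile hs0 hA z'
  have hlog : 1 + Real.log s⁻¹ ≤ 2 * logScale d := by
    have hl2 : Real.log 2 ≤ 1 := by have := Real.log_two_lt_d9; linarith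
    have hm1 := le_max_left 0 (-Real.log d)
    have hm2 := le_max_right 0 (-Real.log d)
    rw [logScale, Real.log_inv]
    rcases min_choice (d / 2) 1 with h | h
    · rw [hs, h, Real.log_div hd0.ne' two_ne_zero]; linarith
    · rw [hs, h, Real.log_one]; linarith
  have hq := one_le_logScale d
  rw [truncField_sub hδ hA]
  calc ‖∫ w in A, (truncKernel δ (z - w) - truncKernel δ (z' - w))‖
      ≤ ∫ w in A, d * (radialProfile s ‖z - w‖ + radialProfile s ‖z' - w‖) := by
        refine norm_integral_le_of_norm_le ((i1.add i2).const_mul d) ?_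
        have n1 : ∀ᵐ w ∂(volume.restrict A), w ≠ z := by
          refine ae_restrict_of_ae ?_
          exact (measure_eq_zero_iff_ae_notMem.1 (measure_singleton z))
        have n2 : ∀ᵐ w ∂(volume.restrict A), w ≠ z' := by
          refine ae_restrict_of_ae ?_
          exact (measure_eq_zero_iff_ae_notMem.1 (measure_singleton z'))
        filter_upwards [n1, n2] with w h1 h2
        refine (norm_truncKernel_sub_le hδ _ _).trans ?_
        rw [sub_sub_sub_cancel_right]
        refine mul_le_mul_of_nonneg_left (inv_mul_inv_le_radialProfile ?_ ?_ ?_) hd0.le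
        · exact norm_pos_iff.2 (sub_ne_zero.2 h1.symm)
        · exact norm_pos_iff.2 (sub_ne_zero.2 h2.symm)
        · have : d ≤ ‖z - w‖ + ‖z' - w‖ := by
            rw [hd, ← sub_sub_sub_cancel_right z z' w]; exact norm_sub_le _ _
          have := min_le_left (d / 2) 1
          linarith
    _ = d * ((∫ w in A, radialProfile s ‖z - w‖) + ∫ w in A, radialProfile s ‖z' - w‖) := by
        rw [integral_const_mul, integral_add i1 i2]
    _ ≤ d * (2 * (2 * Real.pi * (2 * logScale d) + volume.real A)) := by
        have b1 := integral_radialProfile_le hs0 hs1 hA z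
        have b2 := integral_radialProfile_le hs0 hs1 hA z'
        have : 2 * Real.pi * (1 + Real.log s⁻¹) ≤ 2 * Real.pi * (2 * logScale d) := by gcongr
        gcongr
        linarith
    _ ≤ _ := by
        have : volume.real A ≤ volume.real A * logScale d :=
          le_mul_of_one_le_right measureReal_nonneg hq
        nlinarith [mul_le_mul_of_nonneg_left this hd0.le]

/-- The holomorphic part of the derivative of `truncField δ A`. -/
def truncFieldDz (δ : ℝ) (A : Set ℂ) (z : ℂ) : ℂ := ∫ w in A, truncKernelDz δ (z - w)

/-- The antiholomorphic part of the derivative of `truncField δ A`. -/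
def truncFieldDzbar (δ : ℝ) (A : Set ℂ) (z : ℂ) : ℂ := ∫ w in A, truncKernelDzbar δ (z - w)

lemma integrableOn_truncKernelDz (hδ : 0 < δ) (hA : volume A ≠ ⊤) (z : ℂ) :
    IntegrableOn (fun w => truncKernelDz δ (z - w)) A :=
  (integrableOn_const hA (C := (δ ^ 2)⁻¹)).mono'
    ((measurable_truncKernelDz δ).comp (by fun_prop)).aestronglyMeasurable
    (Eventually.of_forall fun w => norm_truncKernelDz_le' hδ _)

lemma integrableOn_truncKernelDzbar (hδ : 0 < δ) (hA : volume A ≠ ⊤) (z : ℂ) :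
    IntegrableOn (fun w => truncKernelDzbar δ (z - w)) A :=
  (integrableOn_const hA (C := (δ ^ 2)⁻¹)).mono'
    ((measurable_truncKernelDzbar δ).comp (by fun_prop)).aestronglyMeasurable
    (Eventually.of_forall fun w => norm_truncKernelDzbar_le hδ _)

lemma hasFDerivAt_truncField (hδ : 0 < δ) (hA : volume A ≠ ⊤) (z : ℂ) :
    HasFDerivAt (truncField δ A) (wirtinger (truncFieldDz δ A z) (truncFieldDzbar δ A z)) z := by
  have key := hasFDerivAt_integral_of_dominated_loc_of_lip (𝕜 := ℝ) (μ := volume.restrict A)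
    (F := fun x w => truncKernel δ (x - w)) (x₀ := z) (s := univ) (bound := fun _ => (δ ^ 2)⁻¹)
    (F' := fun w => wirtinger (truncKernelDz δ (z - w)) (truncKernelDzbar δ (z - w)))
    univ_mem
    (Eventually.of_forall fun x => (integrableOn_truncKernel hδ hA x).aestronglyMeasurable)
    (integrableOn_truncKernel hδ hA z) ?_ ?_ (integrableOn_const hA) ?_
  · obtain ⟨h_int, hder⟩ := key
    have e : ∫ w in A, wirtinger (truncKernelDz δ (z - w)) (truncKernelDzbar δ (z - w)) =
        wirtinger (truncFieldDz δ A z) (truncFieldDzbar δ A z) := ?_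
    · rw [← e]; exact hder
    ext1 h
    rw [ContinuousLinearMap.integral_apply h_int, wirtinger_apply, truncFieldDz, truncFieldDzbar]
    simp only [wirtinger_apply]
    rw [integral_add ((integrableOn_truncKernelDz hδ hA z).mul_const _)
      ((integrableOn_truncKernelDzbar hδ hA z).mul_const _), integral_mul_const,
      integral_mul_const]
  · have m1 := (integrableOn_truncKernelDz hδ hA z).aestronglyMeasurable
    have m2 := (integrableOn_truncKernelDzbar hδ hA z).aestronglyMeasurable
    exact (m1.smul_const _).add (m2.smul_const _)
  · refine Eventually.of_forall fun w => LipschitzWith.lipschitzOnWith ?_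
    refine LipschitzWith.of_dist_le_mul fun x y => ?_
    rw [dist_eq_norm, dist_eq_norm, Real.coe_nnabs, abs_of_pos (by positivity)]
    refine (norm_truncKernel_sub_le_mul hδ _ _).trans_eq ?_
    rw [sub_sub_sub_cancel_right]
  · have : ∀ᵐ w : ℂ, w ∉ sphere z δ :=
      measure_eq_zero_iff_ae_notMem.1 (Measure.addHaar_sphere _ _ _)
    filter_upwards [ae_restrict_of_ae this] with w hw
    have hw' : ‖z - w‖ ≠ δ := by
      rwa [mem_sphere, dist_comm, dist_eq_norm] at hw
    exact (hasFDerivAt_truncKernel hδ hw').comp z ((hasFDerivAt_id z).sub_const w)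

lemma hasDerivAt_truncField (hδ : 0 < δ) (hA : volume A ≠ ⊤) {z : ℂ}
    (hz : ∀ w ∈ A, δ ≤ ‖z - w‖) : HasDerivAt (truncField δ A) (truncFieldDz δ A z) z := by
  have h0 : truncFieldDzbar δ A z = 0 := by
    rw [truncFieldDzbar]
    refine setIntegral_eq_zero_of_forall_eq_zero fun w hw => ?_
    rw [truncKernelDzbar, if_neg (not_lt.2 (hz w hw))]
  have := hasFDerivAt_truncField hδ hA z
  rw [h0] at this
  rw [hasDerivAt_iff_hasFDerivAt]
  refine hasFDerivAt_of_restrictScalars ℝ this ?_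
  ext1 h
  simp [wirtinger_apply, mul_comm]

lemma norm_truncFieldDz_le (hδ : 0 < δ) (hA : volume A ≠ ⊤) {z : ℂ}
    (hz : ∀ w ∈ A, 1 ≤ ‖z - w‖) : ‖truncFieldDz δ A z‖ ≤ volume.real A := by
  refine (norm_setIntegral_le_of_norm_le_const hA.lt_top (C := 1) fun w hw => ?_).trans_eq (by simp)
  refine (norm_truncKernelDz_le hδ _).trans (inv_le_one_of_one_le₀ ?_)
  exact one_le_pow₀ ((hz w hw).trans (le_max_left _ _))

lemma norm_truncFieldDzbar_le (hδ : 0 < δ) (z : ℂ) : ‖truncFieldDzbar δ A z‖ ≤ Real.pi := by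
  have e : (fun w => truncKernelDzbar δ (z - w)) =
      (ball z δ).indicator fun _ => ((δ : ℂ) ^ 2)⁻¹ := by
    classical
    ext w
    rw [truncKernelDzbar, indicator_apply, mem_ball, dist_comm, dist_eq_norm]
  rw [truncFieldDzbar, e, setIntegral_indicator measurableSet_ball]
  simp only [setIntegral_const, norm_smul, norm_inv, norm_pow, Complex.norm_real,
    Real.norm_of_nonneg hδ.le, Real.norm_of_nonneg measureReal_nonneg]
  have : volume.real (A ∩ ball z δ) ≤ volume.real (ball z δ) :=
    measureReal_mono inter_subset_right measure_ball_lt_top.ne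
  have h2 : volume.real (ball z δ) = Real.pi * δ ^ 2 := by
    simp [Measure.real, Complex.volume_ball, hδ.le, mul_comm]
  rw [← div_eq_mul_inv, div_le_iff₀ (by positivity), ← h2]
  exact this

end truncFieldBounds

/-- The trace of a real-linear endomorphism of `ℂ`. -/
def realTrace (L : ℂ →L[ℝ] ℂ) : ℝ := (L 1).re + (L I).im

lemma det_eq_re_im (L : ℂ →L[ℝ] ℂ) : L.det = (L 1).re * (L I).im - (L 1).im * (L I).re := by
  rw [ContinuousLinearMap.det, ← LinearMap.det_toMatrix Complex.basisOneI, Matrix.det_fin_two]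
  simp [LinearMap.toMatrix_apply]
  ring

lemma det_one_add_smul (t : ℝ) (L : ℂ →L[ℝ] ℂ) :
    (1 + t • L).det = 1 + t * realTrace L + t ^ 2 * L.det := by
  simp [det_eq_re_im, realTrace]
  ring

lemma norm_apply_one_le (L : ℂ →L[ℝ] ℂ) : ‖L 1‖ ≤ ‖L‖ := by simpa using L.le_opNorm 1

lemma norm_apply_I_le (L : ℂ →L[ℝ] ℂ) : ‖L I‖ ≤ ‖L‖ := by simpa using L.le_opNorm I

lemma abs_realTrace_le (L : ℂ →L[ℝ] ℂ) : |realTrace L| ≤ 2 * ‖L‖ := by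
  have h1 := (Complex.abs_re_le_norm (L 1)).trans (norm_apply_one_le L)
  have h2 := (Complex.abs_im_le_norm (L I)).trans (norm_apply_I_le L)
  have := abs_add_le (L 1).re (L I).im
  rw [realTrace]; linarith

lemma abs_det_le (L : ℂ →L[ℝ] ℂ) : |L.det| ≤ ‖L‖ ^ 2 := by
  have e : L.det = (starRingEnd ℂ (L 1) * L I).im := by
    rw [det_eq_re_im]; simp; ring
  rw [e]
  refine (Complex.abs_im_le_norm _).trans ?_
  rw [norm_mul, RCLike.norm_conj, sq]
  exact mul_le_mul (norm_apply_one_le L) (norm_apply_I_le L) (norm_nonneg _) (norm_nonneg _)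

lemma realTrace_wirtinger (p q : ℂ) : realTrace (wirtinger p q) = 2 * p.re := by
  simp [realTrace, wirtinger_apply]; ring

lemma det_wirtinger (p q : ℂ) : (wirtinger p q).det = ‖p‖ ^ 2 - ‖q‖ ^ 2 := by
  rw [det_eq_re_im, ← Complex.normSq_eq_norm_sq, ← Complex.normSq_eq_norm_sq]
  simp [wirtinger_apply, Complex.normSq_apply]; ring

lemma norm_wirtinger_le (p q : ℂ) : ‖wirtinger p q‖ ≤ ‖p‖ + ‖q‖ := by
  refine ContinuousLinearMap.opNorm_le_bound _ (by positivity) fun h => ?_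
  rw [wirtinger_apply]
  refine (norm_add_le _ _).trans_eq ?_
  simp; ring

lemma continuous_realTrace : Continuous realTrace := by
  unfold realTrace; fun_prop

lemma continuous_det : Continuous fun L : ℂ →L[ℝ] ℂ => L.det := by
  simp only [det_eq_re_im]; fun_prop

lemma bijective_id_add {v : ℂ → ℂ} {κ : ℝ} (hκ : κ < 1)
    (hv : ∀ z z', ‖v z - v z'‖ ≤ κ * ‖z - z'‖) : Function.Bijective fun z => z + v z := by
  constructor
  · intro z z' h
    have h1 := hv z z'
    have h2 : v z - v z' = -(z - z') := by linear_combination h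
    rw [h2, norm_neg] at h1
    have : ‖z - z'‖ = 0 := by nlinarith [norm_nonneg (z - z')]
    exact sub_eq_zero.1 (norm_eq_zero.1 this)
  · intro w
    have hlip : LipschitzWith κ.toNNReal fun z => w - v z := by
      refine LipschitzWith.of_dist_le_mul fun x y => ?_
      rw [dist_eq_norm, dist_eq_norm, show w - v x - (w - v y) = -(v x - v y) by ring, norm_neg]
      refine (hv x y).trans ?_
      gcongr
      exact Real.le_coe_toNNReal κ
    have hc : ContractingWith κ.toNNReal fun z => w - v z := ⟨by
      rw [← Real.toNNReal_one]; exact (Real.toNNReal_lt_toNNReal_iff one_pos).2 hκ, hlip⟩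
    refine ⟨hc.fixedPoint, ?_⟩
    have : w - v hc.fixedPoint = hc.fixedPoint := hc.fixedPoint_isFixedPt
    linear_combination -this

lemma norm_fderiv_le_of_forall {v : ℂ → ℂ} {K : ℝ} (hK : 0 ≤ K)
    (hv : ∀ z z', ‖v z - v z'‖ ≤ K * ‖z - z'‖) (z : ℂ) : ‖fderiv ℝ v z‖ ≤ K := by
  have : LipschitzWith K.toNNReal v := LipschitzWith.of_dist_le_mul fun x y => by
    rw [dist_eq_norm, dist_eq_norm, Real.coe_toNNReal _ hK]; exact hv x y
  have h := norm_fderiv_le_of_lipschitz ℝ this (x₀ := z)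
  rwa [Real.coe_toNNReal _ hK] at h

section area

variable {v : ℂ → ℂ} {K : ℝ} {A : Set ℂ}

lemma integrableOn_realTrace (hK : 0 ≤ K) (hv : ∀ z z', ‖v z - v z'‖ ≤ K * ‖z - z'‖)
    (hA : volume A ≠ ⊤) : IntegrableOn (fun z => realTrace (fderiv ℝ v z)) A := by
  refine (integrableOn_const hA (C := 2 * K)).mono'
    (continuous_realTrace.measurable.comp (measurable_fderiv ℝ v)).aestronglyMeasurable
    (Eventually.of_forall fun z => (abs_realTrace_le _).trans ?_)
  have := norm_fderiv_le_of_forall hK hv z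
  linarith

lemma integrableOn_det (hK : 0 ≤ K) (hv : ∀ z z', ‖v z - v z'‖ ≤ K * ‖z - z'‖)
    (hA : volume A ≠ ⊤) : IntegrableOn (fun z => (fderiv ℝ v z).det) A := by
  refine (integrableOn_const hA (C := K ^ 2)).mono'
    (continuous_det.measurable.comp (measurable_fderiv ℝ v)).aestronglyMeasurable
    (Eventually.of_forall fun z => (abs_det_le _).trans ?_)
  have := norm_fderiv_le_of_forall hK hv z
  gcongr

lemma volume_image_id_add (hK : 0 ≤ K) (hv : ∀ z z', ‖v z - v z'‖ ≤ K * ‖z - z'‖)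
    (hd : Differentiable ℝ v) (hAm : MeasurableSet A) (hA : volume A ≠ ⊤) {t : ℝ}
    (ht : |t| * K ≤ 1 / 4) :
    volume.real ((fun z => z + t * v z) '' A) = volume.real A +
      t * (∫ z in A, realTrace (fderiv ℝ v z)) + t ^ 2 * ∫ z in A, (fderiv ℝ v z).det := by
  have hder : ∀ z ∈ A, HasFDerivWithinAt (fun z => z + t * v z) (1 + t • fderiv ℝ v z) A z := by
    intro z _
    exact ((hasFDerivAt_id z).add ((hd z).hasFDerivAt.const_smul t)).hasFDerivWithinAt
  have hinj : InjOn (fun z => z + t * v z) A := by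
    refine (bijective_id_add (v := fun z => t * v z) (κ := |t| * K) (by linarith)
      fun z z' => ?_).1.injOn
    rw [← mul_sub, norm_mul, Complex.norm_real, Real.norm_eq_abs, mul_assoc]
    gcongr
    exact hv z z'
  have key := integral_image_eq_integral_abs_det_fderiv_smul volume hAm hder hinj
    (fun _ => (1 : ℝ))
  have i0 : IntegrableOn (fun _ : ℂ => (1 : ℝ)) A := integrableOn_const hA
  have i1 : IntegrableOn (fun z => t * realTrace (fderiv ℝ v z)) A :=
    (integrableOn_realTrace hK hv hA).const_mul t
  have i2 : IntegrableOn (fun z => t ^ 2 * (fderiv ℝ v z).det) A :=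
    (integrableOn_det hK hv hA).const_mul (t ^ 2)
  have i01 : IntegrableOn (fun z => 1 + t * realTrace (fderiv ℝ v z)) A := i0.add i1
  have e : ∀ z, |(1 + t • fderiv ℝ v z).det| • (1 : ℝ) =
      1 + t * realTrace (fderiv ℝ v z) + t ^ 2 * (fderiv ℝ v z).det := by
    intro z
    rw [smul_eq_mul, mul_one, det_one_add_smul, abs_of_nonneg]
    have hn := norm_fderiv_le_of_forall hK hv z
    have ha : |t * realTrace (fderiv ℝ v z)| ≤ 2 * (|t| * K) := by
      rw [abs_mul]
      have := abs_realTrace_le (fderiv ℝ v z)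
      nlinarith [abs_nonneg t]
    have hb : |t ^ 2 * (fderiv ℝ v z).det| ≤ (|t| * K) ^ 2 := by
      rw [abs_mul, abs_pow, mul_pow]
      have := (abs_det_le (fderiv ℝ v z)).trans (pow_le_pow_left₀ (norm_nonneg _) hn 2)
      gcongr
    have := (abs_le.1 ha).1
    have := (abs_le.1 hb).1
    nlinarith [mul_nonneg (abs_nonneg t) hK]
  simp only [e] at key
  rw [integral_add i01 i2, integral_add i0 i1,
    integral_const_mul, integral_const_mul] at key
  simpa using key

lemma integral_det_eq_zero (hK : 0 ≤ K) (hv : ∀ z z', ‖v z - v z'‖ ≤ K * ‖z - z'‖)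
    (hd : Differentiable ℝ v) {ρ : ℝ} (h0 : ∀ z, ρ ≤ ‖z‖ → v z = 0) :
    ∫ z in ball 0 ρ, (fderiv ℝ v z).det = 0 := by
  have him : ∀ t : ℝ, |t| * K ≤ 1 / 4 → (fun z => z + t * v z) '' ball 0 ρ = ball 0 ρ := by
    intro t ht
    have hb : Function.Bijective fun z => z + t * v z := by
      refine bijective_id_add (v := fun z => t * v z) (κ := |t| * K) (by linarith)
        fun z z' => ?_
      rw [← mul_sub, norm_mul, Complex.norm_real, Real.norm_eq_abs, mul_assoc]
      gcongr
      exact hv z z'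
    have hout : ∀ z, ρ ≤ ‖z‖ → (fun z => z + t * v z) z = z := fun z hz => by simp [h0 z hz]
    ext w
    constructor
    · rintro ⟨z, hz, rfl⟩
      by_contra hw
      rw [mem_ball_zero_iff, not_lt] at hw
      have := hb.1 (hout _ hw)
      rw [this] at hw
      exact absurd hz (by simpa using hw)
    · intro hw
      obtain ⟨z, hz⟩ := hb.2 w
      refine ⟨z, ?_, hz⟩
      by_contra hz'
      rw [mem_ball_zero_iff, not_lt] at hz'
      have := (hout z hz').symm.trans hz
      rw [this] at hz'
      exact absurd hw (by simpa using hz')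
  set t : ℝ := 1 / (4 * (K + 1)) with ht
  have t0 : 0 < t := by positivity
  have tK : t * K ≤ 1 / 4 := by
    rw [ht, div_mul_eq_mul_div, div_le_div_iff₀ (by positivity) (by norm_num)]; linarith
  have hfin : volume (ball (0 : ℂ) ρ) ≠ ⊤ := measure_ball_lt_top.ne
  have t1 : |t| * K ≤ 1 / 4 := by rwa [abs_of_pos t0]
  have t2 : |-t| * K ≤ 1 / 4 := by rwa [abs_neg, abs_of_pos t0]
  have e1 := volume_image_id_add hK hv hd measurableSet_ball hfin t1
  have e2 := volume_image_id_add hK hv hd measurableSet_ball hfin t2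
  rw [him _ t1] at e1
  rw [him _ t2] at e2
  have : t ^ 2 * ∫ z in ball 0 ρ, (fderiv ℝ v z).det = 0 := by nlinarith
  exact (mul_eq_zero.1 this).resolve_left (by positivity)

end area

lemma volume_ne_top_of_subset_closedBall {A : Set ℂ} {R : ℝ} (h : A ⊆ closedBall 0 R) :
    volume A ≠ ⊤ :=
  ((measure_mono h).trans_lt measure_closedBall_lt_top).ne

lemma differentiable_truncField {δ : ℝ} {A : Set ℂ} (hδ : 0 < δ) (hA : volume A ≠ ⊤) :
    Differentiable ℝ (truncField δ A) := fun z =>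
  (hasFDerivAt_truncField hδ hA z).differentiableAt

/-- A bound, uniform in `δ` and `A`, on the `L¹` norm over `A` of the divergence
of `truncField δ A`. -/
lemma exists_integral_abs_realTrace_le (R : ℝ) : ∃ C : ℝ, ∀ (δ : ℝ) (A : Set ℂ), 0 < δ →
    MeasurableSet A → A ⊆ closedBall 0 R →
    ∫ z in A, |realTrace (fderiv ℝ (truncField δ A) z)| ≤ C := by
  rcases lt_or_ge R 0 with hR | hR
  · refine ⟨0, fun δ A _ _ hAR => ?_⟩
    rw [closedBall_eq_empty.2 hR, subset_empty_iff] at hAR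
    simp [hAR]
  let f : ContDiffBump (0 : ℂ) := ⟨R + 1, R + 2, by linarith, by linarith⟩
  obtain ⟨Kf, hKf⟩ := (f.contDiff (n := 1)).lipschitzWith_of_hasCompactSupport
    f.hasCompactSupport one_ne_zero
  set V := volume.real (closedBall (0 : ℂ) R)
  set M := 2 * Real.pi + 2 * V with hM
  set B := V + Real.pi + Kf * M with hB
  have hV0 : 0 ≤ V := measureReal_nonneg
  have hM0 : 0 ≤ M := by positivity
  refine ⟨(1 + B ^ 2 + Real.pi ^ 2) * volume.real (ball (0 : ℂ) (R + 2)), fun δ A hδ hAm hAR => ?_⟩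
  have hA := volume_ne_top_of_subset_closedBall hAR
  have hAV : volume.real A ≤ V := measureReal_mono hAR measure_closedBall_lt_top.ne
  have hvM : ∀ z, ‖truncField δ A z‖ ≤ M := fun z =>
    (norm_truncField_le hδ hA z).trans (by linarith)
  set L := (δ ^ 2)⁻¹ * volume.real A
  have hL0 : 0 ≤ L := by positivity
  set u : ℂ → ℂ := fun z => f z • truncField δ A z with hu
  have hul : ∀ z z', ‖u z - u z'‖ ≤ (L + Kf * M) * ‖z - z'‖ := by
    intro z z'
    have e : u z - u z' = f z • (truncField δ A z - truncField δ A z') +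
      (f z - f z') • truncField δ A z' := by simp only [hu, smul_sub, sub_smul]; abel
    have h1 : ‖f z • (truncField δ A z - truncField δ A z')‖ ≤ L * ‖z - z'‖ := by
      rw [norm_smul, Real.norm_of_nonneg f.nonneg]
      exact (mul_le_of_le_one_left (norm_nonneg _) f.le_one).trans
        (norm_truncField_sub_le hδ hA z z')
    have h2 : ‖(f z - f z') • truncField δ A z'‖ ≤ Kf * ‖z - z'‖ * M := by
      rw [norm_smul]
      have := hKf.norm_sub_le z z'
      gcongr
      exact hvM z'
    rw [e]
    refine (norm_add_le _ _).trans ?_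
    linarith
  have hfd : Differentiable ℝ f := (f.contDiff (n := 1)).differentiable one_ne_zero
  have hud : Differentiable ℝ u := hfd.smul (differentiable_truncField hδ hA)
  have hu0 : ∀ z, R + 2 ≤ ‖z‖ → u z = 0 := by
    intro z hz
    simp only [hu]
    rw [f.zero_of_le_dist (by simpa using hz), zero_smul]
  have hdet := integral_det_eq_zero (by positivity) hul hud hu0
  have hfin : volume (ball (0 : ℂ) (R + 2)) ≠ ⊤ := measure_ball_lt_top.ne
  have idet := integrableOn_det (by positivity) hul hfin
  have itr : IntegrableOn (fun z => |realTrace (fderiv ℝ (truncField δ A) z)|) A :=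
    (integrableOn_realTrace hL0 (norm_truncField_sub_le hδ hA) hA).abs
  have hsub : A ⊆ ball 0 (R + 2) := hAR.trans (closedBall_subset_ball (by linarith))
  have hpt : ∀ z, A.indicator (fun z => |realTrace (fderiv ℝ (truncField δ A) z)|) z -
      (1 + B ^ 2 + Real.pi ^ 2) ≤ (fderiv ℝ u z).det := by
    intro z
    have hQ := norm_truncFieldDzbar_le (A := A) hδ z
    by_cases hz : ‖z‖ < R + 1
    · have e : u =ᶠ[𝓝 z] truncField δ A := by
        filter_upwards [isOpen_ball.mem_nhds (show z ∈ ball (0 : ℂ) (R + 1) by simpa using hz)]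
          with y hy
        simp only [hu]
        rw [f.one_of_mem_closedBall (ball_subset_closedBall hy), one_smul]
      have e2 : A.indicator (fun z => |realTrace (fderiv ℝ (truncField δ A) z)|) z ≤
          |realTrace (fderiv ℝ (truncField δ A) z)| :=
        indicator_apply_le' (fun _ => le_rfl) fun _ => abs_nonneg _
      rw [e.fderiv_eq]
      rw [(hasFDerivAt_truncField hδ hA z).fderiv, realTrace_wirtinger] at *
      rw [det_wirtinger]
      have h1 : |2 * (truncFieldDz δ A z).re| ≤ 2 * ‖truncFieldDz δ A z‖ := by
        rw [abs_mul, abs_two]; gcongr; exact Complex.abs_re_le_norm _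
      have h2 := pow_le_pow_left₀ (norm_nonneg _) hQ 2
      nlinarith [sq_nonneg (‖truncFieldDz δ A z‖ - 1), sq_nonneg B]
    · push Not at hz
      have hzA : z ∉ A := fun h => by
        have := hAR h
        rw [mem_closedBall_zero_iff] at this
        linarith
      rw [indicator_of_notMem hzA]
      have hP : ‖truncFieldDz δ A z‖ ≤ V := by
        refine (norm_truncFieldDz_le hδ hA fun w hw => ?_).trans hAV
        have h1 := hAR hw
        rw [mem_closedBall_zero_iff] at h1
        have := norm_sub_norm_le z w
        linarith
      have hDv := (norm_wirtinger_le (truncFieldDz δ A z) (truncFieldDzbar δ A z)).trans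
        (add_le_add hP hQ)
      have hDf : ‖fderiv ℝ f z‖ ≤ Kf := norm_fderiv_le_of_lipschitz ℝ hKf
      have hDu : ‖fderiv ℝ u z‖ ≤ B := by
        have := (hfd z).hasFDerivAt.smul (hasFDerivAt_truncField hδ hA z)
        rw [show fderiv ℝ u z = _ from HasFDerivAt.fderiv this]
        refine (norm_add_le _ _).trans (add_le_add ?_ ?_)
        · rw [norm_smul, Real.norm_of_nonneg f.nonneg]
          exact (mul_le_of_le_one_left (norm_nonneg _) f.le_one).trans hDv
        · rw [ContinuousLinearMap.norm_smulRight_apply]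
          gcongr
          exact hvM z
      have h1 := (abs_le.1 (abs_det_le (fderiv ℝ u z))).1
      have h2 := pow_le_pow_left₀ (norm_nonneg _) hDu 2
      nlinarith [sq_nonneg Real.pi]
  have i1 : IntegrableOn (A.indicator fun z => |realTrace (fderiv ℝ (truncField δ A) z)|)
      (ball 0 (R + 2)) := ((integrable_indicator_iff hAm).2 itr).integrableOn
  have h_int := setIntegral_mono (i1.sub (integrableOn_const hfin)) idet hpt
  rw [hdet] at h_int
  have e3 : ∫ z in ball 0 (R + 2),
      (A.indicator (fun z => |realTrace (fderiv ℝ (truncField δ A) z)|) z - (1 + B ^ 2 + Real.pi ^ 2)) = (∫ z in A, |realTrace (fderiv ℝ (truncField δ A) z)|) -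
      (1 + B ^ 2 + Real.pi ^ 2) * volume.real (ball (0 : ℂ) (R + 2)) := by
    rw [integral_sub i1 (integrableOn_const hfin), setIntegral_indicator hAm,
      inter_eq_self_of_subset_right hsub]
    simp [mul_comm]
  have e4 := e3.symm.trans_le h_int
  linarith

/-- A single Euler step of the flow of `truncField δ A`. -/
def eulerStep (ε δ : ℝ) (A : Set ℂ) (z : ℂ) : ℂ := z + ε * truncField δ A z

lemma exists_volume_eulerStep_le (R : ℝ) : ∃ C : ℝ, 0 ≤ C ∧ ∀ (δ : ℝ) (A : Set ℂ), 0 < δ →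
    MeasurableSet A → A ⊆ closedBall 0 R → ∀ ε : ℝ, 0 ≤ ε →
    ε * ((δ ^ 2)⁻¹ * volume.real (closedBall (0 : ℂ) R)) ≤ 1 / 4 →
    ε * ((δ ^ 2)⁻¹ * volume.real (closedBall (0 : ℂ) R)) ^ 2 ≤ 1 →
    volume.real A - C * ε ≤ volume.real (eulerStep ε δ A '' A) := by
  obtain ⟨C, hC⟩ := exists_integral_abs_realTrace_le R
  set V := volume.real (closedBall (0 : ℂ) R)
  have hV0 : 0 ≤ V := measureReal_nonneg
  refine ⟨|C| + V, by positivity, fun δ A hδ hAm hAR ε hε h1 h2 => ?_⟩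
  have hA := volume_ne_top_of_subset_closedBall hAR
  have hAV : volume.real A ≤ V := measureReal_mono hAR measure_closedBall_lt_top.ne
  set L := (δ ^ 2)⁻¹ * V
  have hL0 : 0 ≤ L := by positivity
  have hlip : ∀ z z', ‖truncField δ A z - truncField δ A z'‖ ≤ L * ‖z - z'‖ := fun z z' =>
    (norm_truncField_sub_le hδ hA z z').trans
      (mul_le_mul_of_nonneg_right (mul_le_mul_of_nonneg_left hAV (by positivity)) (norm_nonneg _))
  have key := volume_image_id_add hL0 hlip (differentiable_truncField hδ hA) hAm hA
    (t := ε) (by rwa [abs_of_nonneg hε])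
  have b1 : |∫ z in A, realTrace (fderiv ℝ (truncField δ A) z)| ≤ |C| :=
    (abs_integral_le_integral_abs.trans (hC δ A hδ hAm hAR)).trans (le_abs_self C)
  have b2 : |∫ z in A, (fderiv ℝ (truncField δ A) z).det| ≤ L ^ 2 * V := by
    have := norm_setIntegral_le_of_norm_le_const hA.lt_top (C := L ^ 2)
      (f := fun z => (fderiv ℝ (truncField δ A) z).det) fun z _ => (abs_det_le _).trans
        (pow_le_pow_left₀ (norm_nonneg _) (norm_fderiv_le_of_forall hL0 hlip z) 2)
    exact this.trans (by gcongr)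
  change _ ≤ volume.real ((fun z => z + ε * truncField δ A z) '' A)
  rw [key]
  have c1 := (abs_le.1 b1).1
  have c2 := (abs_le.1 b2).1
  have d1 := mul_le_mul_of_nonneg_left c1 hε
  have d2 := mul_le_mul_of_nonneg_left c2 (sq_nonneg ε)
  have d3 : ε ^ 2 * (L ^ 2 * V) ≤ ε * V := by
    have := mul_le_mul_of_nonneg_right h2 (mul_nonneg hε hV0)
    nlinarith
  linarith

lemma abs_logScale_sub_le {d d' x : ℝ} (hd : 0 < d) (hx : x ≤ 1 / 2)
    (h : |d' - d| ≤ x * d) : 0 < d' ∧ |logScale d' - logScale d| ≤ 2 * x := by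
  obtain ⟨h1, h2⟩ := abs_le.1 h
  have hx0 : 0 ≤ x := by
    have := (abs_nonneg _).trans h
    exact nonneg_of_mul_nonneg_left this hd
  have hd' : 0 < d' := by nlinarith
  refine ⟨hd', ?_⟩
  have e : logScale d' - logScale d = max (-Real.log d') 0 - max (-Real.log d) 0 := by
    simp only [logScale, max_comm (0 : ℝ)]; ring
  rw [e]
  refine (abs_max_sub_max_le_abs _ _ _).trans ?_
  have l1 : Real.log d' - Real.log d ≤ x := by
    rw [← Real.log_div hd'.ne' hd.ne']
    refine (Real.log_le_sub_one_of_pos (by positivity)).trans ?_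
    rw [sub_le_iff_le_add, div_le_iff₀ hd]; linarith
  have l2 : Real.log d - Real.log d' ≤ 2 * x := by
    rw [← Real.log_div hd.ne' hd'.ne']
    refine (Real.log_le_sub_one_of_pos (by positivity)).trans ?_
    rw [sub_le_iff_le_add, div_le_iff₀ hd']; nlinarith
  rw [abs_le]
  constructor <;> linarith

lemma le_of_logScale_le {d d' : ℝ} (hd : 0 < d) (hd' : 0 < d') (h : logScale d' ≤ 2 * logScale d) :
    min d 1 ^ 2 / 3 ≤ d' := by
  have hm : 0 < min d 1 := lt_min hd one_pos
  have h1 : -Real.log d' ≤ 1 - 2 * Real.log (min d 1) := by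
    have a := le_max_right 0 (-Real.log d')
    have b : max 0 (-Real.log d) = -Real.log (min d 1) := by
      rcases le_total d 1 with hd1 | hd1
      · rw [min_eq_left hd1, max_eq_right]
        linarith [Real.log_nonpos hd.le hd1]
      · rw [min_eq_right hd1, max_eq_left, Real.log_one, neg_zero]
        linarith [Real.log_nonneg hd1]
    simp only [logScale] at h
    linarith
  have h2 : Real.log (min d 1 ^ 2 / 3) ≤ Real.log d' := by
    rw [Real.log_div (by positivity) (by norm_num), Real.log_pow]
    have : 1 ≤ Real.log 3 := by
      rw [Real.le_log_iff_exp_le (by norm_num)]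
      exact Real.exp_one_lt_three.le
    push_cast
    linarith
  exact (Real.log_le_log_iff (by positivity) hd').1 h2

lemma sq_le_of_logScale_le {d d' : ℝ} (hd : 0 < d) (hd' : 0 < d') (hd3 : d < 1 / 3)
    (h : logScale d / 2 ≤ logScale d') : d' ^ 2 ≤ 3 * d := by
  have hlog : 1 < -Real.log d := by
    rw [← Real.log_inv, Real.lt_log_iff_exp_lt (by positivity)]
    refine Real.exp_one_lt_three.trans ?_
    rw [lt_inv_comm₀ (by norm_num) hd]
    linarith
  have b : max 0 (-Real.log d) = -Real.log d := max_eq_right (by linarith)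
  have h3 : 1 ≤ Real.log 3 := by
    rw [Real.le_log_iff_exp_le (by norm_num)]
    exact Real.exp_one_lt_three.le
  simp only [logScale, b] at h
  have c : max 0 (-Real.log d') = -Real.log d' := by
    rcases max_choice 0 (-Real.log d') with hc | hc
    · rw [hc] at h; linarith
    · exact hc
  rw [c] at h
  rw [← Real.log_le_log_iff (by positivity) (by positivity), Real.log_pow,
    Real.log_mul (by norm_num) hd.ne']
  push_cast
  linarith

lemma le_mul_re_truncField {δ R σ : ℝ} {A : Set ℂ} (hδ : 0 < δ) (hδ1 : δ ≤ 1)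
    (hA : A ⊆ closedBall 0 R) (hAm : MeasurableSet A) (hσ : |σ| = 1) {w : ℂ}
    (hw : ‖w - (σ * (R + 3) : ℝ)‖ ≤ 1) :
    volume.real A / (2 * R + 4) ^ 2 ≤ σ * (truncField δ A w).re := by
  have hfin := volume_ne_top_of_subset_closedBall hA
  rcases A.eq_empty_or_nonempty with rfl | ⟨a, ha⟩
  · simp [truncField]
  have hR : 0 ≤ R := by simpa using (norm_nonneg a).trans (by simpa using hA ha)
  have h_int := integrableOn_truncKernel hδ hfin w
  have e : σ * (truncField δ A w).re = ∫ z in A, σ * (truncKernel δ (w - z)).re := by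
    rw [truncField, integral_const_mul]
    exact congrArg _ (integral_re h_int).symm
  rw [e]
  have hc : volume.real A / (2 * R + 4) ^ 2 = ∫ z in A, ((2 * R + 4) ^ 2)⁻¹ := by
    simp [div_eq_mul_inv]
  rw [hc]
  refine setIntegral_mono_on (integrableOn_const hfin) (h_int.re.const_mul σ) hAm fun z hz => ?_
  have hzR : ‖z‖ ≤ R := by simpa using hA hz
  have hσ2 : σ * σ = 1 := by rw [← abs_mul_abs_self, hσ, one_mul]
  have hre : 2 ≤ σ * (w - z).re := by
    have h1 : |σ * (w - (σ * (R + 3) : ℝ)).re| ≤ 1 := by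
      rw [abs_mul, hσ, one_mul]; exact (Complex.abs_re_le_norm _).trans hw
    have h2 : |σ * z.re| ≤ R := by
      rw [abs_mul, hσ, one_mul]; exact (Complex.abs_re_le_norm _).trans hzR
    have h3 := (abs_le.1 h1).1
    have h4 := (abs_le.1 h2).2
    rw [Complex.sub_re, Complex.ofReal_re] at h3
    rw [Complex.sub_re]
    have : σ * (w.re - σ * (R + 3)) = σ * w.re - (R + 3) := by
      linear_combination (-(R + 3)) * hσ2
    linarith
  have hn2 : 2 ≤ ‖w - z‖ := by
    refine hre.trans ((le_abs_self _).trans ?_)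
    rw [abs_mul, hσ, one_mul]; exact Complex.abs_re_le_norm _
  have hn : ‖w - z‖ ≤ 2 * R + 4 := by
    have h1 : ‖((σ * (R + 3) : ℝ) : ℂ)‖ = R + 3 := by
      rw [Complex.norm_real, Real.norm_eq_abs, abs_mul, hσ, one_mul, abs_of_nonneg (by linarith)]
    have h2 : w - z = (w - (σ * (R + 3) : ℝ)) + (σ * (R + 3) : ℝ) - z := by ring
    have := norm_sub_le ((w - (σ * (R + 3) : ℝ)) + (σ * (R + 3) : ℝ)) z
    have := norm_add_le (w - (σ * (R + 3) : ℝ)) (σ * (R + 3) : ℝ)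
    rw [h2]
    linarith
  rw [truncKernel_eq_inv hδ (by linarith), Complex.inv_re, Complex.normSq_eq_norm_sq,
    ← mul_div_assoc, inv_eq_one_div]
  gcongr
  linarith

/-- The Euler scheme for the flow of the Cauchy transform of the transported set. -/
def eulerFlow (ε δ : ℝ) (E : Set ℂ) : ℕ → ℂ → ℂ
  | 0 => id
  | k + 1 => fun z => eulerStep ε δ (eulerFlow ε δ E k '' E) (eulerFlow ε δ E k z)

lemma eulerFlow_succ (ε δ : ℝ) (E : Set ℂ) (k : ℕ) (z : ℂ) : eulerFlow ε δ E (k + 1) z =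
    eulerFlow ε δ E k z + ε * truncField δ (eulerFlow ε δ E k '' E) (eulerFlow ε δ E k z) := rfl

/-- Properties of `k` steps of the Euler scheme: `M` bounds the speed, `κ` is the relative change
of the logarithmic scale in one step and `a` the loss of area. -/
structure EulerFlowBounds (ε δ M κ a : ℝ) (E : Set ℂ) (k : ℕ) : Prop where
  continuous : Continuous (eulerFlow ε δ E k)
  surjective : Function.Surjective (eulerFlow ε δ E k)
  norm_sub_le : ∀ z, ‖eulerFlow ε δ E k z - z‖ ≤ k * (ε * M)
  logScale_mem : ∀ z z', z ≠ z' → 0 < ‖eulerFlow ε δ E k z - eulerFlow ε δ E k z'‖ ∧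
    (1 - κ) ^ k * logScale ‖z - z'‖ ≤ logScale ‖eulerFlow ε δ E k z - eulerFlow ε δ E k z'‖ ∧
    logScale ‖eulerFlow ε δ E k z - eulerFlow ε δ E k z'‖ ≤ (1 + κ) ^ k * logScale ‖z - z'‖
  volume_le : volume.real E - k * a ≤ volume.real (eulerFlow ε δ E k '' E)

lemma eulerFlow_image_subset {ε δ M κ a R : ℝ} {E : Set ℂ} {k : ℕ}
    (h : EulerFlowBounds ε δ M κ a E k) (hk : k * (ε * M) ≤ 1) (hE : E ⊆ closedBall 0 R) :
    eulerFlow ε δ E k '' E ⊆ closedBall 0 (R + 1) := by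
  rintro _ ⟨z, hz, rfl⟩
  have h1 := h.norm_sub_le z
  have h2 : ‖z‖ ≤ R := by simpa using hE hz
  have h3 := norm_add_le (eulerFlow ε δ E k z - z) z
  rw [sub_add_cancel] at h3
  rw [mem_closedBall_zero_iff]
  linarith

lemma eulerFlowBounds {ε δ R T V M C a : ℝ} {E : Set ℂ} {N : ℕ} (hE : IsCompact E)
    (hER : E ⊆ closedBall 0 R) (hε : 0 ≤ ε) (hδ : 0 < δ) (hεN : N * ε = T)
    (hV : V = volume.real (closedBall (0 : ℂ) (R + 1)))
    (hM : M = 2 * Real.pi + 2 * V) (hC : C = 8 * Real.pi + 2 * V)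
    (hTM : T * M ≤ 1) (hTC : T * (2 * C) ≤ 1 / 2) (hL : ε * ((δ ^ 2)⁻¹ * V) ≤ 1 / 4)
    (ha : ∀ A, MeasurableSet A → A ⊆ closedBall 0 (R + 1) →
      volume.real A - a ≤ volume.real (eulerStep ε δ A '' A)) :
    ∀ k ≤ N, EulerFlowBounds ε δ M (ε * (2 * C)) a E k := by
  have hV0 : 0 ≤ V := hV ▸ measureReal_nonneg
  have hM0 : 0 ≤ M := by rw [hM]; positivity
  have hC0 : 0 ≤ C := by rw [hC]; positivity
  intro k
  induction k with
  | zero =>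
    intro _
    refine ⟨continuous_id, Function.surjective_id, fun z => by simp [eulerFlow],
      fun z z' h => ?_, by simp [eulerFlow]⟩
    simpa [eulerFlow, sub_eq_zero] using h
  | succ k ih =>
    intro hk
    have ih := ih (by omega)
    have hkN : (k : ℝ) * (ε * M) ≤ 1 := by
      have : (k : ℝ) ≤ N := by exact_mod_cast (by omega : k ≤ N)
      calc (k : ℝ) * (ε * M) ≤ N * (ε * M) := by gcongr
        _ = T * M := by rw [← hεN]; ring
        _ ≤ 1 := hTM
    have hNC : ε * (2 * C) ≤ 1 / 2 := by
      have : (1 : ℝ) ≤ N := by exact_mod_cast (by omega : 1 ≤ N)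
      calc ε * (2 * C) ≤ N * (ε * (2 * C)) := le_mul_of_one_le_left (by positivity) this
        _ = T * (2 * C) := by rw [← hεN]; ring
        _ ≤ _ := hTC
    set A := eulerFlow ε δ E k '' E with hAdef
    have hAR : A ⊆ closedBall 0 (R + 1) := eulerFlow_image_subset ih hkN hER
    have hAm : MeasurableSet A := (hE.image ih.continuous).measurableSet
    have hA := volume_ne_top_of_subset_closedBall hAR
    have hAV : volume.real A ≤ V :=
      hV ▸ measureReal_mono hAR measure_closedBall_lt_top.ne
    have hstep : ∀ z, eulerFlow ε δ E (k + 1) z = eulerStep ε δ A (eulerFlow ε δ E k z) :=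
      fun z => rfl
    have hlip : ∀ z z', ‖ε * truncField δ A z - ε * truncField δ A z'‖ ≤
        (ε * ((δ ^ 2)⁻¹ * V)) * ‖z - z'‖ := by
      intro z z'
      rw [← mul_sub, norm_mul, Complex.norm_real, Real.norm_of_nonneg hε, mul_assoc]
      exact mul_le_mul_of_nonneg_left ((norm_truncField_sub_le hδ hA z z').trans
        (mul_le_mul_of_nonneg_right (mul_le_mul_of_nonneg_left hAV (by positivity))
          (norm_nonneg _))) hε
    refine ⟨?_, ?_, fun z => ?_, fun z z' hz => ?_, ?_⟩
    · exact ih.continuous.add (continuous_const.mul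
        ((differentiable_truncField hδ hA).continuous.comp ih.continuous))
    · exact (bijective_id_add (v := fun z => ε * truncField δ A z) (by linarith) hlip).2.comp
        ih.surjective
    · have h1 := ih.norm_sub_le z
      have h2 : ‖ε * truncField δ A (eulerFlow ε δ E k z)‖ ≤ ε * M := by
        rw [norm_mul, Complex.norm_real, Real.norm_of_nonneg hε]
        have := norm_truncField_le hδ hA (eulerFlow ε δ E k z)
        gcongr
        linarith
      have e : eulerFlow ε δ E (k + 1) z - z = (eulerFlow ε δ E k z - z) +
        ε * truncField δ A (eulerFlow ε δ E k z) := by rw [eulerFlow_succ]; ring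
      rw [e]
      refine (norm_add_le _ _).trans ?_
      push_cast
      linarith
    · obtain ⟨i0, i1, i2⟩ := ih.logScale_mem z z' hz
      set w := eulerFlow ε δ E k z
      set w' := eulerFlow ε δ E k z'
      have hw : w ≠ w' := sub_ne_zero.1 (norm_pos_iff.1 i0)
      have hq := one_le_logScale ‖w - w'‖
      have e : eulerFlow ε δ E (k + 1) z - eulerFlow ε δ E (k + 1) z' =
        (w - w') + (ε * truncField δ A w - ε * truncField δ A w') := by
        rw [eulerFlow_succ, eulerFlow_succ]; ring
      have hdiff : |‖eulerFlow ε δ E (k + 1) z - eulerFlow ε δ E (k + 1) z'‖ - ‖w - w'‖| ≤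
          ‖ε * truncField δ A w - ε * truncField δ A w'‖ := by
        rw [e]
        refine (abs_norm_sub_norm_le _ _).trans_eq ?_
        rw [add_sub_cancel_left]
      have hlog : ‖ε * truncField δ A w - ε * truncField δ A w'‖ ≤
          (ε * (C * logScale ‖w - w'‖)) * ‖w - w'‖ := by
        rw [← mul_sub, norm_mul, Complex.norm_real, Real.norm_of_nonneg hε, mul_assoc]
        refine mul_le_mul_of_nonneg_left ((norm_truncField_sub_le_log hδ hA hw).trans ?_) hε
        rw [hC]
        gcongr
      have hmin : |‖eulerFlow ε δ E (k + 1) z - eulerFlow ε δ E (k + 1) z'‖ - ‖w - w'‖| ≤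
          min (ε * ((δ ^ 2)⁻¹ * V)) (ε * (C * logScale ‖w - w'‖)) * ‖w - w'‖ := by
        rw [min_mul_of_nonneg _ _ (norm_nonneg _)]
        exact le_min (hdiff.trans (hlip _ _)) (hdiff.trans hlog)
      obtain ⟨p0, p1⟩ := abs_logScale_sub_le i0 ((min_le_left _ _).trans (by linarith)) hmin
      have p2 : 2 * min (ε * ((δ ^ 2)⁻¹ * V)) (ε * (C * logScale ‖w - w'‖)) ≤
          ε * (2 * C) * logScale ‖w - w'‖ := by
        have := min_le_right (ε * ((δ ^ 2)⁻¹ * V)) (ε * (C * logScale ‖w - w'‖))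
        linarith
      obtain ⟨p3, p4⟩ := abs_le.1 (p1.trans p2)
      refine ⟨p0, ?_, ?_⟩
      · rw [pow_succ]
        have := mul_le_mul_of_nonneg_left i1 (show 0 ≤ 1 - ε * (2 * C) by linarith)
        linarith
      · rw [pow_succ]
        have := mul_le_mul_of_nonneg_left i2 (show 0 ≤ 1 + ε * (2 * C) by positivity)
        linarith
    · have h1 := ha A hAm hAR
      have h2 := ih.volume_le
      have e : eulerFlow ε δ E (k + 1) '' E = eulerStep ε δ A '' A := by
        rw [hAdef, image_image]; rfl
      rw [e]
      push_cast
      linarith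

/-- A quasi-homeomorphism of the plane at scale `δ`: surjective, close to the identity,
bi-Hölder with fixed constants, holomorphic at points whose distance to `E` is large compared with
`δ`, and pushing `X` and `-X` outwards by at least `c`. -/
structure IsHolderApprox (δ X c : ℝ) (E : Set ℂ) (φ : ℂ → ℂ) : Prop where
  surjective : Function.Surjective φ
  norm_sub_le : ∀ z, ‖φ z - z‖ ≤ 1
  le_norm_sub : ∀ z z', min ‖z - z'‖ 1 ^ 2 / 3 ≤ ‖φ z - φ z'‖
  sq_norm_sub_le : ∀ z z', ‖z - z'‖ < 1 / 3 → ‖φ z - φ z'‖ ^ 2 ≤ 3 * ‖z - z'‖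
  differentiableAt : ∀ z η, 0 < η → δ ≤ min η 1 ^ 2 / 3 → (∀ w ∈ E, η ≤ ‖z - w‖) →
    DifferentiableAt ℂ φ z
  le_mul_re : ∀ σ : ℝ, |σ| = 1 → c ≤ σ * (φ (σ * X : ℝ) - (σ * X : ℝ)).re

lemma EulerFlowBounds.logScale_bounds {ε δ M κ a : ℝ} {E : Set ℂ} {k : ℕ}
    (h : EulerFlowBounds ε δ M κ a E k) (hκ : 0 ≤ κ) (hkκ : k * κ ≤ 1 / 2) {z z' : ℂ}
    (hz : z ≠ z') :
    logScale ‖z - z'‖ / 2 ≤ logScale ‖eulerFlow ε δ E k z - eulerFlow ε δ E k z'‖ ∧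
    logScale ‖eulerFlow ε δ E k z - eulerFlow ε δ E k z'‖ ≤ 2 * logScale ‖z - z'‖ := by
  obtain ⟨-, h1, h2⟩ := h.logScale_mem z z' hz
  have hq := one_le_logScale ‖z - z'‖
  rcases Nat.eq_zero_or_pos k with rfl | hk
  · simp only [pow_zero, one_mul] at h1 h2
    constructor <;> linarith
  have hk1 : (1 : ℝ) ≤ k := by exact_mod_cast hk
  have hκ1 : κ ≤ 1 / 2 := (le_mul_of_one_le_left hκ hk1).trans hkκ
  constructor
  · have b := one_add_mul_le_pow (a := -κ) (by linarith) k
    rw [← sub_eq_add_neg] at b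
    have : 1 / 2 ≤ (1 - κ) ^ k := by linarith
    have := mul_le_mul_of_nonneg_right this (zero_le_one.trans hq)
    linarith
  · have b : (1 + κ) ^ k ≤ 2 := by
      calc (1 + κ) ^ k ≤ Real.exp κ ^ k := by
            gcongr; linarith [Real.add_one_le_exp κ]
        _ = Real.exp (k * κ) := (Real.exp_nat_mul _ _).symm
        _ ≤ Real.exp (Real.log 2) := by
            gcongr; linarith [Real.log_two_gt_d9]
        _ = 2 := Real.exp_log two_pos
    exact h2.trans (mul_le_mul_of_nonneg_right b (zero_le_one.trans hq))

lemma EulerFlowBounds.le_norm_sub {ε δ M κ a : ℝ} {E : Set ℂ} {k : ℕ}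
    (h : EulerFlowBounds ε δ M κ a E k) (hκ : 0 ≤ κ) (hkκ : k * κ ≤ 1 / 2) (z z' : ℂ) :
    min ‖z - z'‖ 1 ^ 2 / 3 ≤ ‖eulerFlow ε δ E k z - eulerFlow ε δ E k z'‖ := by
  rcases eq_or_ne z z' with rfl | hz
  · simp
  · exact le_of_logScale_le (norm_pos_iff.2 (sub_ne_zero.2 hz)) (h.logScale_mem z z' hz).1
      (h.logScale_bounds hκ hkκ hz).2

lemma differentiableAt_eulerFlow {ε δ M κ a R : ℝ} {E : Set ℂ} {N : ℕ}
    (hδ : 0 < δ) (hκ : 0 ≤ κ) (hNκ : N * κ ≤ 1 / 2) (hεM : 0 ≤ ε * M) (hN : N * (ε * M) ≤ 1)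
    (hER : E ⊆ closedBall 0 R)
    (h : ∀ k ≤ N, EulerFlowBounds ε δ M κ a E k) {z : ℂ} {η : ℝ}
    (hδη : δ ≤ min η 1 ^ 2 / 3) (hη : 0 < η) (hz : ∀ w ∈ E, η ≤ ‖z - w‖) :
    ∀ k ≤ N, DifferentiableAt ℂ (eulerFlow ε δ E k) z := by
  intro k
  induction k with
  | zero => exact fun _ => differentiableAt_id
  | succ k ih =>
    intro hk
    have ih := ih (by omega)
    have hb := h k (by omega)
    have hkN : (k : ℝ) ≤ N := by exact_mod_cast (by omega : k ≤ N)
    have hA := volume_ne_top_of_subset_closedBall (eulerFlow_image_subset hb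
      ((mul_le_mul_of_nonneg_right hkN hεM).trans hN) hER)
    have hd : ∀ w ∈ eulerFlow ε δ E k '' E, δ ≤ ‖eulerFlow ε δ E k z - w‖ := by
      rintro _ ⟨w, hw, rfl⟩
      refine (hδη.trans ?_).trans
        (hb.le_norm_sub hκ ((mul_le_mul_of_nonneg_right hkN hκ).trans hNκ) z w)
      have := hz w hw
      gcongr
    exact ih.add (((hasDerivAt_truncField hδ hA hd).differentiableAt.comp z ih).const_mul _)

lemma le_mul_re_eulerFlow {ε δ M κ a R v : ℝ} {E : Set ℂ} {N : ℕ} (hE : IsCompact E)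
    (hδ : 0 < δ) (hδ1 : δ ≤ 1) (hε : 0 ≤ ε) (hεM : 0 ≤ ε * M) (hN : N * (ε * M) ≤ 1)
    (ha : 0 ≤ a) (hv : v ≤ volume.real E - N * a) (hER : E ⊆ closedBall 0 R)
    (h : ∀ k ≤ N, EulerFlowBounds ε δ M κ a E k) {σ : ℝ} (hσ : |σ| = 1) :
    ∀ k ≤ N, k * ε * (v / (2 * (R + 1) + 4) ^ 2) ≤
      σ * (eulerFlow ε δ E k (σ * ((R + 1) + 3) : ℝ) - (σ * ((R + 1) + 3) : ℝ)).re := by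
  intro k
  induction k with
  | zero => simp [eulerFlow]
  | succ k ih =>
    intro hk
    have ih := ih (by omega)
    have hb := h k (by omega)
    have hkN : (k : ℝ) ≤ N := by exact_mod_cast (by omega : k ≤ N)
    have hk1 : (k : ℝ) * (ε * M) ≤ 1 := (mul_le_mul_of_nonneg_right hkN hεM).trans hN
    have h1 := le_mul_re_truncField hδ hδ1 (eulerFlow_image_subset hb hk1 hER)
      (hE.image hb.continuous).measurableSet hσ
      ((hb.norm_sub_le (σ * ((R + 1) + 3) : ℝ)).trans hk1)
    have h2 : v / (2 * (R + 1) + 4) ^ 2 ≤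
        volume.real (eulerFlow ε δ E k '' E) / (2 * (R + 1) + 4) ^ 2 := by
      have := hb.volume_le
      have := mul_le_mul_of_nonneg_right hkN ha
      gcongr
      linarith
    have h3 := mul_le_mul_of_nonneg_left (h2.trans h1) hε
    rw [eulerFlow_succ, add_sub_right_comm, Complex.add_re, Complex.re_ofReal_mul]
    push_cast at ih h3 ⊢
    linarith

lemma exists_isHolderApprox {E : Set ℂ} (hE : IsCompact E) (hpos : 0 < volume E) :
    ∃ X c : ℝ, 0 < c ∧ ∀ δ, 0 < δ → δ ≤ 1 → ∃ φ, IsHolderApprox δ X c E φ := by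
  obtain ⟨R, hR0, hER⟩ := hE.isBounded.subset_closedBall_lt 0 0
  have hEv : 0 < volume.real E := ENNReal.toReal_pos hpos.ne' hE.measure_lt_top.ne
  obtain ⟨C₂, hC₂, hvol⟩ := exists_volume_eulerStep_le (R + 1)
  set V := volume.real (closedBall (0 : ℂ) (R + 1)) with hV
  have hV0 : 0 ≤ V := measureReal_nonneg
  obtain ⟨M, hM⟩ : ∃ M, M = 2 * Real.pi + 2 * V := ⟨_, rfl⟩
  obtain ⟨C, hC⟩ : ∃ C, C = 8 * Real.pi + 2 * V := ⟨_, rfl⟩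
  have hM0 : 0 < M := by rw [hM]; positivity
  have hC0 : 0 < C := by rw [hC]; positivity
  obtain ⟨T, hT, hTM, hTC, hTa⟩ : ∃ T : ℝ, 0 < T ∧ T * M ≤ 1 ∧ T * (2 * C) ≤ 1 / 2 ∧
      T * C₂ ≤ volume.real E / 2 := by
    have h1 : ∀ᶠ T : ℝ in 𝓝[>] 0, T * M < 1 :=
      ((Continuous.tendsto' (by fun_prop) 0 0 (by simp)).mono_left
        nhdsWithin_le_nhds).eventually_lt_const one_pos
    have h2 : ∀ᶠ T : ℝ in 𝓝[>] 0, T * (2 * C) < 1 / 2 :=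
      ((Continuous.tendsto' (by fun_prop) 0 0 (by simp)).mono_left
        nhdsWithin_le_nhds).eventually_lt_const (by norm_num)
    have h3 : ∀ᶠ T : ℝ in 𝓝[>] 0, T * C₂ < volume.real E / 2 :=
      ((Continuous.tendsto' (by fun_prop) 0 0 (by simp)).mono_left
        nhdsWithin_le_nhds).eventually_lt_const (by positivity)
    obtain ⟨T, hT, a, b, c⟩ := (eventually_mem_nhdsWithin.and (h1.and (h2.and h3))).exists
    exact ⟨T, hT, a.le, b.le, c.le⟩
  refine ⟨(R + 1) + 3, T * ((volume.real E / 2) / (2 * (R + 1) + 4) ^ 2), by positivity,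
    fun δ hδ hδ1 => ?_⟩
  obtain ⟨L, hL⟩ : ∃ L, L = (δ ^ 2)⁻¹ * V := ⟨_, rfl⟩
  obtain ⟨N, hN, hN1, hN2⟩ : ∃ N : ℕ, 0 < N ∧ T / N * L ≤ 1 / 4 ∧ T / N * L ^ 2 ≤ 1 := by
    have h0 := tendsto_const_div_atTop_nhds_zero_nat T
    have h1 := (h0.mul_const L).eventually_lt_const (u := 1 / 4) (by norm_num)
    have h2 := (h0.mul_const (L ^ 2)).eventually_lt_const (u := 1) (by norm_num)
    obtain ⟨N, hN, a, b⟩ := ((eventually_gt_atTop 0).and (h1.and h2)).exists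
    exact ⟨N, hN, a.le, b.le⟩
  have hNr : (0 : ℝ) < N := by exact_mod_cast hN
  obtain ⟨ε, hεd⟩ : ∃ ε, ε = T / N := ⟨_, rfl⟩
  have hε : 0 ≤ ε := by rw [hεd]; positivity
  have hεN : N * ε = T := by rw [hεd]; field_simp
  rw [← hεd, hL] at hN1 hN2
  have hb := eulerFlowBounds (a := C₂ * ε) hE hER hε hδ hεN hV hM hC hTM hTC hN1
    fun A hA hAR => hvol δ A hδ hA hAR ε hε hN1 hN2
  have hNκ : N * (ε * (2 * C)) ≤ 1 / 2 := by rw [← mul_assoc, hεN]; exact hTC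
  have hNM : N * (ε * M) ≤ 1 := by rw [← mul_assoc, hεN]; exact hTM
  have hκ : 0 ≤ ε * (2 * C) := by positivity
  have hεM : 0 ≤ ε * M := by positivity
  have hbN := hb N le_rfl
  refine ⟨eulerFlow ε δ E N, hbN.surjective, fun z => (hbN.norm_sub_le z).trans hNM,
    hbN.le_norm_sub hκ hNκ, fun z z' hz => ?_, fun z η hη hδη hz =>
      differentiableAt_eulerFlow hδ hκ hNκ hεM hNM hER hb hδη hη hz N le_rfl, fun σ hσ => ?_⟩
  · rcases eq_or_ne z z' with rfl | hne
    · simp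
    · exact sq_le_of_logScale_le (norm_pos_iff.2 (sub_ne_zero.2 hne)) (hbN.logScale_mem z z' hne).1
        hz (hbN.logScale_bounds hκ hNκ hne).1
  · have := le_mul_re_eulerFlow (v := volume.real E / 2) hE hδ hδ1 hε hεM hNM (by positivity)
      (by have : N * (C₂ * ε) = T * C₂ := by rw [← hεN]; ring
          linarith) hER hb hσ N le_rfl
    rwa [hεN] at this

namespace IsHolderApprox

variable {δ X c : ℝ} {E : Set ℂ} {φ : ℂ → ℂ}

lemma norm_sub_lt (h : IsHolderApprox δ X c E φ) {r : ℝ} (hr : 0 < r) {z z' : ℂ}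
    (hz : ‖z - z'‖ < min (1 / 3) (r ^ 2 / 3)) : ‖φ z - φ z'‖ < r := by
  have h1 := h.sq_norm_sub_le z z' (hz.trans_le (min_le_left _ _))
  have h2 := hz.trans_le (min_le_right _ _)
  exact lt_of_pow_lt_pow_left₀ 2 hr.le (by linarith)

end IsHolderApprox

/-- Hölder approximations at scales tending to `0` have a limit, which is a homeomorphism
and holomorphic off `E`. -/
lemma exists_homeomorph_of_isHolderApprox {ι : Type*} {l : Filter ι} [l.NeBot] {δ : ι → ℝ}
    {X c : ℝ} {E : Set ℂ} (hE : IsClosed E) (hδ : Tendsto δ l (𝓝 0)) {φ : ι → ℂ → ℂ}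
    (h : ∀ i, IsHolderApprox (δ i) X c E (φ i)) :
    ∃ f : ℂ ≃ₜ ℂ, (∀ z ∉ E, DifferentiableAt ℂ f z) ∧ (∀ z, ‖f z - z‖ ≤ 1) ∧
      ∀ σ : ℝ, |σ| = 1 → c ≤ σ * (f (σ * X : ℝ) - (σ * X : ℝ)).re := by
  wlog hl : ∃ u : Ultrafilter ι, l = u generalizing l
  · exact this (l := (Ultrafilter.of l : Filter ι)) (hδ.mono_left (Ultrafilter.of_le l)) ⟨_, rfl⟩
  obtain ⟨u, rfl⟩ := hl
  have hlim : ∀ (R : ℝ) (g : ι → ℂ), (∀ i, ‖g i‖ ≤ R) → ∃ w, Tendsto g u (𝓝 w) := by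
    intro R g hg
    obtain ⟨w, -, hw⟩ := (isCompact_closedBall (0 : ℂ) R).ultrafilter_le_nhds (u.map g)
      (le_principal_iff.2 (mem_map.2 (univ_mem' fun i => by simpa using hg i)))
    exact ⟨w, hw⟩
  have hex : ∀ z, ∃ w, Tendsto (fun i => φ i z) u (𝓝 w) := fun z => by
    refine hlim (‖z‖ + 1) _ fun i => ?_
    have h1 := (h i).norm_sub_le z
    have h2 := norm_le_norm_add_norm_sub' (φ i z) z
    linarith
  choose f hf using hex
  have hf1 : ∀ z, ‖f z - z‖ ≤ 1 := fun z =>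
    le_of_tendsto ((hf z).sub_const z).norm (.of_forall fun i => (h i).norm_sub_le z)
  have hf2 : ∀ z z', min ‖z - z'‖ 1 ^ 2 / 3 ≤ ‖f z - f z'‖ := fun z z' =>
    ge_of_tendsto ((hf z).sub (hf z')).norm (.of_forall fun i => (h i).le_norm_sub z z')
  have hf3 : ∀ r, 0 < r → ∀ z z', ‖z - z'‖ < min (1 / 3) (r ^ 2 / 3) → ‖f z - f z'‖ ≤ r :=
    fun r hr z z' hz => le_of_tendsto ((hf z).sub (hf z')).norm
      (.of_forall fun i => ((h i).norm_sub_lt hr hz).le)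
  have hcont : Continuous f := by
    rw [Metric.continuous_iff]
    intro z r hr
    refine ⟨min (1 / 3) ((r / 2) ^ 2 / 3), by positivity, fun z' hz => ?_⟩
    rw [dist_eq_norm] at hz ⊢
    linarith [hf3 (r / 2) (by positivity) z' z hz]
  have hloc : TendstoLocallyUniformly φ f u := by
    rw [Metric.tendstoLocallyUniformly_iff]
    intro r hr z
    have hr3 : 0 < r / 3 := by positivity
    refine ⟨ball z (min (1 / 3) ((r / 3) ^ 2 / 3)), ball_mem_nhds z (by positivity), ?_⟩
    filter_upwards [(Metric.tendsto_nhds.1 (hf z)) (r / 3) hr3] with i hi y hy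
    rw [mem_ball, dist_eq_norm] at hy
    have h1 := hf3 _ hr3 y z hy
    have h2 := (h i).norm_sub_lt hr3 hy
    rw [← dist_eq_norm] at h1 h2
    have h3 := dist_triangle4_right (f y) (φ i y) (f z) (φ i z)
    rw [dist_comm] at hi
    linarith
  have hinj : Function.Injective f := by
    intro z z' hz
    by_contra hne
    have h1 := hf2 z z'
    have h2 : 0 < ‖z - z'‖ := norm_pos_iff.2 (sub_ne_zero.2 hne)
    rw [hz, sub_self, norm_zero] at h1
    have : 0 < min ‖z - z'‖ 1 ^ 2 / 3 := by positivity
    linarith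
  have hsurj : Function.Surjective f := by
    intro w
    choose g hg using fun i => (h i).surjective w
    obtain ⟨z, hz⟩ := hlim (‖w‖ + 1) g fun i => by
      have h1 := (h i).norm_sub_le (g i)
      rw [hg] at h1
      have h2 := norm_le_norm_add_norm_sub' (g i) w
      rw [norm_sub_rev] at h1
      linarith
    refine ⟨z, tendsto_nhds_unique (hloc.tendsto_comp hcont.continuousAt hz) ?_⟩
    simp [hg]
  have hinv : Continuous (Equiv.ofBijective f ⟨hinj, hsurj⟩).symm := by
    set e := Equiv.ofBijective f ⟨hinj, hsurj⟩
    rw [Metric.continuous_iff]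
    intro w r hr
    refine ⟨min r 1 ^ 2 / 3, by positivity, fun w' hw => ?_⟩
    have h1 := hf2 (e.symm w') (e.symm w)
    have e1 : ∀ w, f (e.symm w) = w := e.apply_symm_apply
    rw [e1, e1] at h1
    rw [dist_eq_norm] at hw ⊢
    by_contra! hcon
    have : min r 1 ^ 2 / 3 ≤ min ‖e.symm w' - e.symm w‖ 1 ^ 2 / 3 := by gcongr
    linarith
  refine ⟨⟨Equiv.ofBijective f ⟨hinj, hsurj⟩, hcont, hinv⟩, fun z hz => ?_, hf1, fun σ hσ => ?_⟩
  · obtain ⟨r, hr, hball⟩ := Metric.isOpen_iff.1 hE.isOpen_compl z hz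
    have hr2 : 0 < r / 2 := by positivity
    refine ((hloc.tendstoLocallyUniformlyOn (s := ball z (r / 2))).differentiableOn ?_
      isOpen_ball).differentiableAt (ball_mem_nhds z hr2)
    have hpos : 0 < min (r / 2) 1 ^ 2 / 3 := by positivity
    filter_upwards [hδ.eventually_le_const hpos] with i hi x hx
    refine ((h i).differentiableAt x (r / 2) hr2 hi fun w hw => ?_).differentiableWithinAt
    by_contra! hcon
    refine hball (mem_ball.2 ?_) hw
    have := dist_triangle w x z
    rw [← dist_eq_norm, dist_comm] at hcon
    have := mem_ball.1 hx
    linarith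
  · exact ge_of_tendsto ((Complex.continuous_re.tendsto _).comp ((hf _).sub_const _) |>.const_mul σ)
      (.of_forall fun i => (h i).le_mul_re σ hσ)

lemma IsMobiusOn.exists_affine {f : ℂ → ℂ} (h : IsMobiusOn f univ) :
    ∃ α β : ℂ, ∀ z, f z = α * z + β := by
  obtain ⟨a, b, c, d, -, h⟩ := h
  have hc : c = 0 := by
    by_contra hc
    refine (h (-d / c) (mem_univ _)).1 ?_
    field_simp
    ring
  refine ⟨a / d, b / d, fun z => ?_⟩
  rw [(h z (mem_univ _)).2, hc]
  ring

lemma IsMobiusOn.exists_translation {f : ℂ → ℂ} (h : IsMobiusOn f univ)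
    {C : ℝ} (hf : ∀ z, ‖f z - z‖ ≤ C) : ∃ β : ℂ, ∀ z, f z = z + β := by
  obtain ⟨α, β, h⟩ := h.exists_affine
  suffices α = 1 from ⟨β, fun z => by rw [h, this, one_mul]⟩
  by_contra hα
  have hα' : α - 1 ≠ 0 := sub_ne_zero.2 hα
  have := hf ((C + 1 : ℝ) / (α - 1) - β / (α - 1))
  have e : f ((C + 1 : ℝ) / (α - 1) - β / (α - 1)) - ((C + 1 : ℝ) / (α - 1) - β / (α - 1)) =
      (C + 1 : ℝ) := by
    rw [h]; field_simp; ring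
  rw [e, Complex.norm_real, Real.norm_eq_abs] at this
  linarith [le_abs_self (C + 1)]

/-- Totally disconnected compact sets of positive area are not conformally removable: there is a
homeomorphism of `ℂ`, conformal off the set, that is not a Möbius transformation. -/
theorem positive_area_not_removable (E : Set ℂ) (hcpt : IsCompact E)
    (htd : ∀ x ∈ E, connectedComponentIn E x = {x})
    (hpos : 0 < volume E) :
    ∃ h : Homeomorph ℂ ℂ, (∀ z ∉ E, DifferentiableAt ℂ (h : ℂ → ℂ) z) ∧
      ¬ IsMobiusOn (h : ℂ → ℂ) Set.univ := by
  obtain ⟨X, c, hc, hφ⟩ := exists_isHolderApprox hcpt hpos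
  choose φ hφ using fun n : ℕ => hφ (1 / ((n : ℝ) + 1)) (by positivity)
    (by rw [div_le_one (by positivity)]; linarith [n.cast_nonneg (α := ℝ)])
  obtain ⟨f, hd, hf, hre⟩ := exists_homeomorph_of_isHolderApprox hcpt.isClosed
    tendsto_one_div_add_atTop_nhds_zero_nat hφ
  refine ⟨f, hd, fun hM => ?_⟩
  obtain ⟨β, hβ⟩ := hM.exists_translation hf
  have h1 := hre 1 (by simp)
  have h2 := hre (-1) (by simp)
  rw [hβ, add_sub_cancel_left] at h1 h2
  linarith
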